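/- Let P be a unitary operator on H and let γ : (−ε, ε) → U(H) be a curve of unitaries with γ(0) = P such that for every t, {γ(t)|e_n⟩⟨e_n|γ(t)* : 1 ≤ n ≤ d} = {P|e_n⟩⟨e_n|P* : 1 ≤ n ≤ d} as sets (i.e., γ stays in the fiber over the decomposition determined by P). Suppose there is an operator Q on H such that for every vector h ∈ H, (γ(t)h − P h)/t → Q h as t → 0. Then there exist complex numbers α_1, …, α_d such that Q = ∑_{n=1}^d α_n P|e_n⟩⟨e_n|. -/

import Mathlib

/- STATEMENT 7: A vertically tangent vector Q at a unitary P (for a curve staying in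
the fiber over the decomposition {P|e_n⟩⟨e_n|P*}) has the form Q = ∑ α_n P|e_n⟩⟨e_n|. -/

noncomputable section

abbrev E (d : ℕ) : Type := EuclideanSpace ℂ (Fin d)
abbrev Op (d : ℕ) : Type := E d →L[ℂ] E d

/-- The rank-one operator `|x⟩⟨y| : h ↦ ⟨y, h⟩ x`. -/
def rankOne {d : ℕ} (x y : E d) : Op d :=
  (ContinuousLinearMap.toSpanSingleton ℂ x).comp (innerSL ℂ y)

/-- The standard orthonormal basis vector `e_n` of `ℂ^d`. -/
def stdVec (d : ℕ) (n : Fin d) : E d := EuclideanSpace.single n 1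

/-- The standard rank-one projection `p_n = |e_n⟩⟨e_n|`. -/
def stdProj (d : ℕ) (n : Fin d) : Op d := rankOne (stdVec d n) (stdVec d n)

lemma rankOne_apply {d : ℕ} (x y h : E d) : rankOne x y h = inner ℂ y h • x := by
  simp [rankOne]

lemma inner_stdVec {d : ℕ} (n m : Fin d) :
    inner ℂ (stdVec d n) (stdVec d m) = if n = m then (1 : ℂ) else 0 :=
  orthonormal_iff_ite.mp (EuclideanSpace.orthonormal_single (𝕜 := ℂ)) n m

lemma stdProj_stdVec (d : ℕ) (n m : Fin d) :
    stdProj d n (stdVec d m) = if n = m then stdVec d n else 0 := by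
  rw [stdProj, rankOne_apply, inner_stdVec, ite_smul, one_smul, zero_smul]

/-- If `U|e_n⟩⟨e_n|U* = P|e_m⟩⟨e_m|P*` with `U` unitary, then `U e_n` is a multiple of `P e_m`. -/
lemma apply_stdVec_mem_span {d : ℕ} {U P : Op d} (hU : U ∈ unitary (Op d)) {n m : Fin d}
    (h : U * stdProj d n * star U = P * stdProj d m * star P) :
    U (stdVec d n) ∈ Submodule.span ℂ {P (stdVec d m)} := by
  have hn : U * stdProj d n = P * stdProj d m * star P * U := by
    rw [← h, mul_assoc (U * _), Unitary.star_mul_self_of_mem hU, mul_one]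
  have hv := DFunLike.congr_fun hn (stdVec d n)
  simp only [mul_apply_eq_comp, stdProj_stdVec, if_true] at hv
  rw [hv, stdProj, rankOne_apply, map_smul]
  exact Submodule.smul_mem _ _ (Submodule.mem_span_singleton_self _)

/-- The columns of a unitary are orthonormal. -/
lemma inner_unitary_stdVec {d : ℕ} {P : Op d} (hP : P ∈ unitary (Op d)) (n m : Fin d) :
    inner ℂ (P (stdVec d n)) (P (stdVec d m)) = if n = m then (1 : ℂ) else 0 := by
  rw [← ContinuousLinearMap.adjoint_inner_right, ← ContinuousLinearMap.star_eq_adjoint,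
    ← mul_apply_eq_comp, Unitary.star_mul_self_of_mem hP]
  exact inner_stdVec n m

/-- If `P` is unitary, `γ : (−ε, ε) → U(H)` is a curve with `γ(0) = P` staying in the
fiber over the decomposition `{P|e_n⟩⟨e_n|P* : n}`, and `Q` satisfies
`(γ(t)h − Ph)/t → Qh` for every `h ∈ H`, then `Q = ∑_n α_n P|e_n⟩⟨e_n|` for some
complex numbers `α_n`. -/
theorem vertical_tangent_vector (d : ℕ) (hd : 1 ≤ d)
    (P : Op d) (hP : P ∈ unitary (Op d)) (ε : ℝ) (hε : 0 < ε)
    (γ : ℝ → Op d)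
    (hγu : ∀ t ∈ Set.Ioo (-ε) ε, γ t ∈ unitary (Op d))
    (hγfib : ∀ t ∈ Set.Ioo (-ε) ε,
      {q : Op d | ∃ n, q = γ t * stdProj d n * star (γ t)} =
        {q : Op d | ∃ n, q = P * stdProj d n * star P})
    (hγ0 : γ 0 = P)
    (Q : Op d)
    (hQ : ∀ h : E d, Filter.Tendsto (fun t : ℝ => t⁻¹ • (γ t h - P h))
      (nhdsWithin 0 (Set.Ioo (-ε) ε \ {0})) (nhds (Q h))) :
    ∃ α : Fin d → ℂ, Q = ∑ n, α n • (P * stdProj d n) := by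
  have hnhds : nhdsWithin (0 : ℝ) (Set.Ioo (-ε) ε \ {0}) = nhdsWithin 0 {0}ᶜ := by
    rw [Set.sdiff_eq, Set.inter_comm]
    exact nhdsWithin_inter_of_mem' (mem_nhdsWithin_of_mem_nhds (Ioo_mem_nhds (by linarith) hε))
  have hIoo : ∀ᶠ t : ℝ in nhdsWithin 0 {0}ᶜ, t ∈ Set.Ioo (-ε) ε :=
    mem_nhdsWithin_of_mem_nhds (Ioo_mem_nhds (by linarith) hε)
  rw [hnhds] at hQ
  have hspan (n : Fin d) : Q (stdVec d n) ∈ Submodule.span ℂ {P (stdVec d n)} := by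
    have hcont : Filter.Tendsto (fun t : ℝ => γ t (stdVec d n)) (nhdsWithin 0 {0}ᶜ)
        (nhds (P (stdVec d n))) := by
      have hid : Filter.Tendsto (fun t : ℝ => t) (nhdsWithin 0 {0}ᶜ) (nhds 0) :=
        tendsto_nhdsWithin_of_tendsto_nhds Filter.tendsto_id
      have hlim := (hid.smul (hQ (stdVec d n))).add_const (P (stdVec d n))
      rw [zero_smul, zero_add] at hlim
      refine hlim.congr' ?_
      filter_upwards [self_mem_nhdsWithin] with t ht
      rw [smul_inv_smul₀ ht, sub_add_cancel]
    have hne : ∀ᶠ t : ℝ in nhdsWithin 0 {0}ᶜ,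
        inner ℂ (P (stdVec d n)) (γ t (stdVec d n)) ≠ 0 := by
      refine (Filter.Tendsto.inner tendsto_const_nhds hcont).eventually_ne ?_
      rw [inner_unitary_stdVec hP, if_pos rfl]
      exact one_ne_zero
    refine (Submodule.closed_of_finiteDimensional _).mem_of_tendsto (hQ (stdVec d n)) ?_
    filter_upwards [hIoo, hne] with t ht hnt
    obtain ⟨m, hm⟩ : γ t * stdProj d n * star (γ t) ∈
        {q : Op d | ∃ n, q = P * stdProj d n * star P} := hγfib t ht ▸ ⟨n, rfl⟩
    have hmem := apply_stdVec_mem_span (hγu t ht) hm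
    obtain rfl : n = m := by
      by_contra hnm
      obtain ⟨c, hc⟩ := Submodule.mem_span_singleton.mp hmem
      exact hnt (by rw [← hc, inner_smul_right, inner_unitary_stdVec hP, if_neg hnm, mul_zero])
    exact Submodule.smul_of_tower_mem _ _
      (Submodule.sub_mem _ hmem (Submodule.mem_span_singleton_self _))
  choose α hα using fun n => Submodule.mem_span_singleton.mp (hspan n)
  refine ⟨α, ContinuousLinearMap.coe_injective
    ((EuclideanSpace.basisFun (Fin d) ℂ).toBasis.ext fun n => ?_)⟩
  have hb : (EuclideanSpace.basisFun (Fin d) ℂ).toBasis n = stdVec d n := by simp [stdVec]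
  rw [hb, ContinuousLinearMap.coe_coe, ContinuousLinearMap.coe_coe, ← hα n]
  simp [stdProj_stdVec, apply_ite P]
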